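/- For every weighted concurrent game structure G whose weight function takes values in a finite set V ⊆ [0,1] with {0,1} ⊆ V, the suprema and infima in the semantics of SL[F] are attained: for every formula ∃x.φ, assignment χ and history ρ, there exists a strategy σ such that ⟦φ⟧^G_{χ[x↦σ]}(ρ) = ⟦∃x.φ⟧^G_χ(ρ); and for every formula Aψ, assignment χ and history ρ, there exists a χ-consistent play π extending ρ such that ⟦ψ⟧^G_χ(π, |ρ|−1) = ⟦Aψ⟧^G_χ(ρ). -/

import Mathlib

open scoped Classical

/-- A weighted concurrent game structure over agents `Agt`, atomic propositions `AP`,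
actions `Act` and positions `Pos`. -/
structure WCGS (Agt AP Act Pos : Type) where
  init : Pos
  tr : Pos → (Agt → Act) → Pos
  wt : AP → Pos → ℝ

variable {Agt AP Act Pos Var : Type}

/-- Histories, represented as reversed nonempty lists of positions
(the head of the list is the last position of the history). -/
inductive IsHist (G : WCGS Agt AP Act Pos) : List Pos → Prop
  | base : IsHist G [G.init]
  | step {ρ : List Pos} {pos : Pos} (h : IsHist G (pos :: ρ)) (c : Agt → Act) :
      IsHist G (G.tr pos c :: pos :: ρ)

/-- A strategy maps (reversed) histories to actions. -/
abbrev Strategy (Act Pos : Type) := List Pos → Act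

/-- An assignment is a partial map from agents and variables to strategies. -/
abbrev Assignment (Agt Var Act Pos : Type) := Agt ⊕ Var → Option (Strategy Act Pos)

/-- The (reversed) prefix `π_0 … π_i` of a play. -/
def pref (π : ℕ → Pos) (i : ℕ) : List Pos := ((List.range (i + 1)).map π).reverse

/-- The play `π` extends the history `ρ`, is a play of `G`, and is `χ`-consistent
from `ρ` on. -/
def Consistent (G : WCGS Agt AP Act Pos) (χ : Assignment Agt Var Act Pos)
    (ρ : List Pos) (π : ℕ → Pos) : Prop :=
  π 0 = G.init ∧ pref π (ρ.length - 1) = ρ ∧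
    ∀ i, ∃ c : Agt → Act, π (i + 1) = G.tr (π i) c ∧
      (ρ.length - 1 ≤ i → ∀ a σ, χ (Sum.inl a) = some σ → c a = σ (pref π i))

mutual
/-- SL[F] state formulas. -/
inductive SLs (AP Var Agt : Type) : Type where
  | atom : AP → SLs AP Var Agt
  | app : (n : ℕ) → ((Fin n → ℝ) → ℝ) → (Fin n → SLs AP Var Agt) → SLs AP Var Agt
  | exS : Var → SLs AP Var Agt → SLs AP Var Agt
  | bind : Agt → Var → SLs AP Var Agt → SLs AP Var Agt
  | All : SLp AP Var Agt → SLs AP Var Agt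
/-- SL[F] path formulas. -/
inductive SLp (AP Var Agt : Type) : Type where
  | state : SLs AP Var Agt → SLp AP Var Agt
  | next : SLp AP Var Agt → SLp AP Var Agt
  | until_ : SLp AP Var Agt → SLp AP Var Agt → SLp AP Var Agt
  | app : (n : ℕ) → ((Fin n → ℝ) → ℝ) → (Fin n → SLp AP Var Agt) → SLp AP Var Agt
end

mutual
/-- Satisfaction value of an SL[F] state formula on a history (reversed list). -/
noncomputable def ssemSL (G : WCGS Agt AP Act Pos) :
    SLs AP Var Agt → Assignment Agt Var Act Pos → List Pos → ℝ
  | .atom p, _, ρ => G.wt p (ρ.headD G.init)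
  | .app n f args, χ, ρ => f fun i => ssemSL G (args i) χ ρ
  | .exS x φ, χ, ρ =>
      sSup {v | ∃ σ : Strategy Act Pos,
        ssemSL G φ (fun y => if y = Sum.inr x then some σ else χ y) ρ = v}
  | .bind a x φ, χ, ρ =>
      ssemSL G φ (fun y => if y = Sum.inl a then χ (Sum.inr x) else χ y) ρ
  | .All ψ, χ, ρ =>
      sInf {v | ∃ π : ℕ → Pos, Consistent G χ ρ π ∧
        psemSL G ψ χ π (ρ.length - 1) = v}
/-- Satisfaction value of an SL[F] path formula on a play at an index. -/
noncomputable def psemSL (G : WCGS Agt AP Act Pos) :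
    SLp AP Var Agt → Assignment Agt Var Act Pos → (ℕ → Pos) → ℕ → ℝ
  | .state φ, χ, π, i => ssemSL G φ χ (pref π i)
  | .next ψ, χ, π, i => psemSL G ψ χ π (i + 1)
  | .until_ ψ₁ ψ₂, χ, π, i =>
      sSup {v | ∃ k, i ≤ k ∧
        v = min (psemSL G ψ₂ χ π k)
          (sInf ({w | ∃ j, i ≤ j ∧ j < k ∧ psemSL G ψ₁ χ π j = w} ∪ {1}))}
  | .app n f args, χ, π, i => f fun j => psemSL G (args j) χ π i
end

/-- An application of a function to arguments from finite sets takes finitely many values. -/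
lemma finite_image_pi {n : ℕ} (f : (Fin n → ℝ) → ℝ) {S : Fin n → Set ℝ}
    (hS : ∀ i, (S i).Finite) : (f '' Set.univ.pi S).Finite :=
  (Set.Finite.pi' hS).image f |>.subset (by
    rintro _ ⟨v, hv, rfl⟩
    exact ⟨v, fun i => hv i trivial, rfl⟩)

lemma sInf_mem_insert_zero_of_subset {S T : Set ℝ} (hT : T.Finite) (hST : S ⊆ T) :
    sInf S ∈ insert 0 T := by
  rcases S.eq_empty_or_nonempty with rfl | hne
  · simp
  · exact Or.inr (hST (hne.csInf_mem (hT.subset hST)))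

mutual
/-- A state formula takes only finitely many values over all assignments and histories. -/
theorem exists_finite_ssemSL_mem [Nonempty Act] (G : WCGS Agt AP Act Pos)
    (hG : ∀ p, (Set.range (G.wt p)).Finite) :
    (φ : SLs AP Var Agt) → ∃ S : Set ℝ, S.Finite ∧ ∀ χ ρ, ssemSL G φ χ ρ ∈ S
  | .atom p => ⟨_, hG p, fun χ ρ => by rw [ssemSL]; exact ⟨_, rfl⟩⟩
  | .app _ f args => by
    choose S hS hmem using fun i => exists_finite_ssemSL_mem G hG (args i)
    refine ⟨_, finite_image_pi f hS, fun χ ρ => ?_⟩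
    rw [ssemSL]
    exact ⟨_, fun i _ => hmem i χ ρ, rfl⟩
  | .exS x φ => by
    obtain ⟨S, hS, hmem⟩ := exists_finite_ssemSL_mem G hG φ
    refine ⟨S, hS, fun χ ρ => ?_⟩
    rw [ssemSL]
    have hsub : {v | ∃ σ : Strategy Act Pos,
        ssemSL G φ (fun y => if y = Sum.inr x then some σ else χ y) ρ = v} ⊆ S := by
      rintro _ ⟨σ, rfl⟩
      exact hmem _ _
    exact hsub (Set.Nonempty.csSup_mem ⟨_, Classical.arbitrary _, rfl⟩ (hS.subset hsub))
  | .bind a x φ => by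
    obtain ⟨S, hS, hmem⟩ := exists_finite_ssemSL_mem G hG φ
    refine ⟨S, hS, fun χ ρ => ?_⟩
    rw [ssemSL]
    exact hmem _ _
  | .All ψ => by
    obtain ⟨S, hS, hmem⟩ := exists_finite_psemSL_mem G hG ψ
    refine ⟨_, hS.insert 0, fun χ ρ => ?_⟩
    rw [ssemSL]
    refine sInf_mem_insert_zero_of_subset hS ?_
    rintro _ ⟨π, -, rfl⟩
    exact hmem _ _ _
/-- A path formula takes only finitely many values over all assignments, plays and indices. -/
theorem exists_finite_psemSL_mem [Nonempty Act] (G : WCGS Agt AP Act Pos)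
    (hG : ∀ p, (Set.range (G.wt p)).Finite) :
    (ψ : SLp AP Var Agt) → ∃ S : Set ℝ, S.Finite ∧ ∀ χ π i, psemSL G ψ χ π i ∈ S
  | .state φ => by
    obtain ⟨S, hS, hmem⟩ := exists_finite_ssemSL_mem G hG φ
    refine ⟨S, hS, fun χ π i => ?_⟩
    rw [psemSL]
    exact hmem _ _
  | .next ψ => by
    obtain ⟨S, hS, hmem⟩ := exists_finite_psemSL_mem G hG ψ
    refine ⟨S, hS, fun χ π i => ?_⟩
    rw [psemSL]
    exact hmem _ _ _
  | .until_ ψ₁ ψ₂ => by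
    obtain ⟨S₁, hS₁, hmem₁⟩ := exists_finite_psemSL_mem G hG ψ₁
    obtain ⟨S₂, hS₂, hmem₂⟩ := exists_finite_psemSL_mem G hG ψ₂
    have hfin := hS₂.image2 min (hS₁.insert 1)
    refine ⟨_, hfin, fun χ π i => ?_⟩
    rw [psemSL]
    have hsub : {v | ∃ k, i ≤ k ∧ v = min (psemSL G ψ₂ χ π k)
        (sInf ({w | ∃ j, i ≤ j ∧ j < k ∧ psemSL G ψ₁ χ π j = w} ∪ {1}))} ⊆
        Set.image2 min S₂ (insert 1 S₁) := by
      rintro _ ⟨k, -, rfl⟩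
      refine Set.mem_image2_of_mem (hmem₂ _ _ _) ?_
      have hsub₁ : {w | ∃ j, i ≤ j ∧ j < k ∧ psemSL G ψ₁ χ π j = w} ∪ {1} ⊆ insert 1 S₁ := by
        rintro _ (⟨j, -, -, rfl⟩ | rfl)
        · exact Or.inr (hmem₁ _ _ _)
        · exact Or.inl rfl
      exact hsub₁ (Set.Nonempty.csInf_mem ⟨1, Or.inr rfl⟩ ((hS₁.insert 1).subset hsub₁))
    exact hsub (Set.Nonempty.csSup_mem ⟨_, i, le_rfl, rfl⟩ (hfin.subset hsub))
  | .app _ f args => by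
    choose S hS hmem using fun i => exists_finite_psemSL_mem G hG (args i)
    refine ⟨_, finite_image_pi f hS, fun χ π i => ?_⟩
    rw [psemSL]
    exact ⟨_, fun j _ => hmem j χ π i, rfl⟩
end

/-- The play obtained by letting `μ` choose the joint action after each history, together with
its prefixes: the pair of the current position and the (reversed) list of earlier positions. -/
def outcome (G : WCGS Agt AP Act Pos) (μ : List Pos → Agt → Act) : ℕ → Pos × List Pos
  | 0 => (G.init, [])
  | n + 1 =>
    let s := outcome G μ n
    (G.tr s.1 (μ (s.1 :: s.2)), s.1 :: s.2)

/-- The (reversed) history reached after `n` steps of the outcome of `μ`. -/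
def outcomeHist (G : WCGS Agt AP Act Pos) (μ : List Pos → Agt → Act) (n : ℕ) : List Pos :=
  (outcome G μ n).1 :: (outcome G μ n).2

lemma outcomeHist_succ (G : WCGS Agt AP Act Pos) (μ : List Pos → Agt → Act) (n : ℕ) :
    outcomeHist G μ (n + 1) =
      G.tr (outcome G μ n).1 (μ (outcomeHist G μ n)) :: outcomeHist G μ n := rfl

lemma length_outcomeHist (G : WCGS Agt AP Act Pos) (μ : List Pos → Agt → Act) (n : ℕ) :
    (outcomeHist G μ n).length = n + 1 := by
  induction n with
  | zero => rfl
  | succ n ih => rw [outcomeHist_succ, List.length_cons, ih]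

lemma pref_succ (π : ℕ → Pos) (n : ℕ) : pref π (n + 1) = π (n + 1) :: pref π n := by
  simp [pref, List.range_succ (n := n + 1)]

lemma pref_outcome (G : WCGS Agt AP Act Pos) (μ : List Pos → Agt → Act) (n : ℕ) :
    pref (fun i => (outcome G μ i).1) n = outcomeHist G μ n := by
  induction n with
  | zero => rfl
  | succ n ih => rw [pref_succ, ih]; rfl

lemma outcomeHist_congr (G : WCGS Agt AP Act Pos) {μ ν : List Pos → Agt → Act} {n : ℕ}
    (h : ∀ l : List Pos, l.length ≤ n → μ l = ν l) :
    outcomeHist G μ n = outcomeHist G ν n := by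
  induction n with
  | zero => rfl
  | succ n ih =>
    have ih' := ih fun l hl => h l (by omega)
    have hhead : (outcome G μ n).1 = (outcome G ν n).1 := (List.cons.inj ih').1
    rw [outcomeHist_succ, outcomeHist_succ, ih', hhead,
      h _ (length_outcomeHist G ν n).le]

lemma IsHist.exists_outcomeHist_eq [Nonempty Act] {G : WCGS Agt AP Act Pos} {ρ : List Pos}
    (hρ : IsHist G ρ) : ∃ μ, outcomeHist G μ (ρ.length - 1) = ρ := by
  induction hρ with
  | base => exact ⟨Classical.arbitrary _, rfl⟩
  | @step ρ pos _ c ih =>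
    obtain ⟨μ, hμ⟩ := ih
    refine ⟨fun l => if l.length ≤ ρ.length then μ l else c, ?_⟩
    have heq := outcomeHist_congr G (n := ρ.length) (μ := μ)
      (ν := fun l => if l.length ≤ ρ.length then μ l else c) fun l hl => (if_pos hl).symm
    simp only [List.length_cons, Nat.add_sub_cancel] at hμ ⊢
    rw [hμ] at heq
    rw [outcomeHist_succ, ← heq, show (outcome G _ ρ.length).1 = pos from (List.cons.inj heq).1.symm]
    simp

lemma IsHist.length_pos {G : WCGS Agt AP Act Pos} {ρ : List Pos} (hρ : IsHist G ρ) :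
    0 < ρ.length := by
  cases hρ <;> simp

/-- Every history extends to a consistent play. -/
lemma IsHist.exists_consistent [Nonempty Act] {G : WCGS Agt AP Act Pos} {ρ : List Pos}
    (hρ : IsHist G ρ) (χ : Assignment Agt Var Act Pos) : ∃ π, Consistent G χ ρ π := by
  obtain ⟨μ, hμ⟩ := hρ.exists_outcomeHist_eq
  have hpos := hρ.length_pos
  let ν : List Pos → Agt → Act := fun l =>
    if l.length < ρ.length then μ l
    else fun a => (χ (Sum.inl a)).elim (Classical.arbitrary Act) fun σ => σ l
  refine ⟨fun i => (outcome G ν i).1, rfl, ?_, fun i => ⟨ν (outcomeHist G ν i), rfl, ?_⟩⟩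
  · rw [pref_outcome, ← outcomeHist_congr G (μ := μ), hμ]
    intro l hl
    exact (if_pos (by omega)).symm
  · intro hi a σ hσ
    rw [pref_outcome]
    have hlen := length_outcomeHist G ν i
    simp only [ν] at hlen ⊢
    rw [if_neg (by omega), hσ]
    rfl

/-- Over a WCGS with weights in a finite set `V ⊆ [0,1]` containing
`0` and `1`, the suprema and infima in the SL[F] semantics are attained: the supremum
over strategies in the semantics of `∃x.φ`, and the infimum over `χ`-consistent plays
in the semantics of `Aψ`. -/
theorem stmt9 {Agt AP Act Pos Var : Type}
    [Fintype Agt] [Fintype AP] [Fintype Act] [Fintype Pos] [Fintype Var]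
    [Nonempty Act]
    (G : WCGS Agt AP Act Pos)
    (V : Set ℝ) (hVfin : V.Finite) (hVsub : V ⊆ Set.Icc (0 : ℝ) 1)
    (h0 : (0 : ℝ) ∈ V) (h1 : (1 : ℝ) ∈ V)
    (hwt : ∀ p pos, G.wt p pos ∈ V) :
    (∀ (x : Var) (φ : SLs AP Var Agt) (χ : Assignment Agt Var Act Pos)
        (ρ : List Pos), IsHist G ρ →
      ∃ σ : Strategy Act Pos,
        ssemSL G φ (fun y => if y = Sum.inr x then some σ else χ y) ρ =
          ssemSL G (SLs.exS x φ) χ ρ) ∧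
    (∀ (ψ : SLp AP Var Agt) (χ : Assignment Agt Var Act Pos)
        (ρ : List Pos), IsHist G ρ →
      ∃ π : ℕ → Pos, Consistent G χ ρ π ∧
        psemSL G ψ χ π (ρ.length - 1) = ssemSL G (SLs.All ψ) χ ρ) := by
  have hG : ∀ p, (Set.range (G.wt p)).Finite := fun p =>
    hVfin.subset (Set.range_subset_iff.2 (hwt p))
  refine ⟨fun x φ χ ρ _ => ?_, fun ψ χ ρ hρ => ?_⟩
  · obtain ⟨S, hS, hmem⟩ := exists_finite_ssemSL_mem G hG φ
    rw [ssemSL]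
    refine Set.Nonempty.csSup_mem (s := {v | ∃ σ : Strategy Act Pos,
      ssemSL G φ (fun y => if y = Sum.inr x then some σ else χ y) ρ = v})
      ⟨_, Classical.arbitrary _, rfl⟩ (hS.subset ?_)
    rintro _ ⟨σ, rfl⟩
    exact hmem _ _
  · obtain ⟨S, hS, hmem⟩ := exists_finite_psemSL_mem G hG ψ
    obtain ⟨π, hπ⟩ := hρ.exists_consistent χ
    rw [ssemSL]
    refine Set.Nonempty.csInf_mem (s := {v | ∃ π : ℕ → Pos, Consistent G χ ρ π ∧
      psemSL G ψ χ π (ρ.length - 1) = v}) ⟨_, π, hπ, rfl⟩ (hS.subset ?_)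
    rintro _ ⟨π, -, rfl⟩
    exact hmem _ _ _
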